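/- If E is a non-trivial regular equational theory and Γ is a NUOF E-unification problem, then Γ does not have a finite minimal complete set of E-unifiers w.r.t. the unrestricted instantiation preorder ≤_E^V. -/

import Mathlib

namespace UnifFW

/-- First-order terms over a signature `F` (an arity-indexed family of function
symbols), with variables from the countably infinite set `V = ℕ`. -/
inductive Term (F : ℕ → Type) : Type
  | var : ℕ → Term F
  | app : (n : ℕ) → F n → (Fin n → Term F) → Term F

variable {F : ℕ → Type}

/-- The set of variables occurring in a term. -/
def Term.vars : Term F → Set ℕ
  | .var x => {x}
  | .app _ _ ts => ⋃ i, (ts i).vars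

/-- Homomorphic extension of a map `V → T(Σ,V)` to terms. -/
def Term.subst (σ : ℕ → Term F) : Term F → Term F
  | .var x => σ x
  | .app n f ts => .app n f (fun i => (ts i).subst σ)

/-- The congruence `≈_E` induced by a set `E` of identities: the smallest
equivalence relation containing all substitution instances of identities of `E`
and compatible with the term constructors. -/
inductive EqE (E : Set (Term F × Term F)) : Term F → Term F → Prop
  | ax {s t : Term F} (σ : ℕ → Term F) : (s, t) ∈ E → EqE E (s.subst σ) (t.subst σ)
  | refl (t : Term F) : EqE E t t
  | symm {s t : Term F} : EqE E s t → EqE E t s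
  | trans {s t u : Term F} : EqE E s t → EqE E t u → EqE E s u
  | congr {n : ℕ} (f : F n) {ts us : Fin n → Term F} :
      (∀ i, EqE E (ts i) (us i)) → EqE E (.app n f ts) (.app n f us)

/-- A theory is non-trivial if distinct variables are not equated. -/
def NonTrivial (E : Set (Term F × Term F)) : Prop :=
  ∀ x y : ℕ, x ≠ y → ¬ EqE E (.var x) (.var y)

/-- A theory is regular if both sides of each identity have the same variables. -/
def Regular (E : Set (Term F × Term F)) : Prop :=
  ∀ p ∈ E, (Prod.fst p).vars = (Prod.snd p).vars

/-- A substitution: a map `V → T(Σ,V)` with finite domain. -/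
structure Subst (F : ℕ → Type) where
  toFun : ℕ → Term F
  finite_dom : {x : ℕ | toFun x ≠ Term.var x}.Finite

/-- The domain of a substitution. -/
def Subst.Dom (σ : Subst F) : Set ℕ := {x : ℕ | σ.toFun x ≠ Term.var x}

/-- The variable range of a substitution: all variables occurring in the images
of domain variables. -/
def Subst.VRan (σ : Subst F) : Set ℕ := ⋃ x ∈ σ.Dom, (σ.toFun x).vars

/-- The instantiation preorder `σ ≤_E^X θ`: some substitution `λ` satisfies
`λ(σ(x)) ≈_E θ(x)` for all `x ∈ X`. -/
def InstLE (E : Set (Term F × Term F)) (X : Set ℕ) (σ θ : Subst F) : Prop :=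
  ∃ lam : Subst F, ∀ x ∈ X, EqE E ((σ.toFun x).subst lam.toFun) (θ.toFun x)

/-- The equivalence `σ ∼_E^X θ` induced by the instantiation preorder. -/
def InstEquiv (E : Set (Term F × Term F)) (X : Set ℕ) (σ θ : Subst F) : Prop :=
  InstLE E X σ θ ∧ InstLE E X θ σ

/-- The strict instantiation order `σ <_E^X θ`. -/
def InstLT (E : Set (Term F × Term F)) (X : Set ℕ) (σ θ : Subst F) : Prop :=
  InstLE E X σ θ ∧ ¬ InstLE E X θ σ

/-- The set of variables occurring in a unification problem. -/
def VarsP (Γ : Set (Term F × Term F)) : Set ℕ :=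
  ⋃ p ∈ Γ, (Prod.fst p).vars ∪ (Prod.snd p).vars

/-- `σ` is an `E`-unifier of the unification problem `Γ`. -/
def Unifier (E Γ : Set (Term F × Term F)) (σ : Subst F) : Prop :=
  ∀ p ∈ Γ, EqE E ((Prod.fst p).subst σ.toFun) ((Prod.snd p).subst σ.toFun)

/-- A unification problem is solvable if it has a unifier. -/
def Solvable (E Γ : Set (Term F × Term F)) : Prop := ∃ σ : Subst F, Unifier E Γ σ

/-- `S` is a complete set of `E`-unifiers of `Γ` w.r.t. `≤_E^X`. -/
def CompleteSet (E Γ : Set (Term F × Term F)) (X : Set ℕ) (S : Set (Subst F)) : Prop :=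
  (∀ σ ∈ S, Unifier E Γ σ) ∧ ∀ θ : Subst F, Unifier E Γ θ → ∃ σ ∈ S, InstLE E X σ θ

/-- `S` is a minimal complete set of `E`-unifiers of `Γ` w.r.t. `≤_E^X`:
complete, and no two distinct elements are comparable. -/
def MinimalComplete (E Γ : Set (Term F × Term F)) (X : Set ℕ) (S : Set (Subst F)) : Prop :=
  CompleteSet E Γ X S ∧ ∀ σ ∈ S, ∀ θ ∈ S, σ ≠ θ → ¬ InstLE E X σ θ

/-- `Γ` has unification type unitary w.r.t. `≤_E^X`. -/
def TypeUnitary (E Γ : Set (Term F × Term F)) (X : Set ℕ) : Prop :=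
  ∃ σ : Subst F, MinimalComplete E Γ X {σ}

/-- `Γ` has unification type finitary w.r.t. `≤_E^X`. -/
def TypeFinitary (E Γ : Set (Term F × Term F)) (X : Set ℕ) : Prop :=
  ∃ S : Set (Subst F), MinimalComplete E Γ X S ∧ S.Finite ∧ 1 < S.ncard

/-- `Γ` has unification type infinitary w.r.t. `≤_E^X`. -/
def TypeInfinitary (E Γ : Set (Term F × Term F)) (X : Set ℕ) : Prop :=
  ∃ S : Set (Subst F), MinimalComplete E Γ X S ∧ S.Infinite

/-- `Γ` has unification type zero w.r.t. `≤_E^X`. -/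
def TypeZero (E Γ : Set (Term F × Term F)) (X : Set ℕ) : Prop :=
  ¬ ∃ S : Set (Subst F), MinimalComplete E Γ X S

/-- `σ` is a `≤_E^X`-minimal `E`-unifier of `Γ`. -/
def MinUnifier (E Γ : Set (Term F × Term F)) (X : Set ℕ) (σ : Subst F) : Prop :=
  Unifier E Γ σ ∧ ∀ θ : Subst F, Unifier E Γ θ → InstLE E X θ σ → InstLE E X σ θ

/-- The set `C_E(Γ)` of unifiers all of whose range variables occur in the
images of at least two distinct variables. -/
def CSet (E Γ : Set (Term F × Term F)) : Set (Subst F) :=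
  {σ : Subst F | Unifier E Γ σ ∧
    ∀ y ∈ σ.VRan, ∃ x x' : ℕ, x ≠ x' ∧ y ∈ (σ.toFun x).vars ∩ (σ.toFun x').vars}

/-- `E` is Noetherian w.r.t. the unrestricted instantiation preorder: there is
no infinite strictly descending chain `σ₁ >_E^V σ₂ >_E^V ⋯`. -/
def Noetherian (E : Set (Term F × Term F)) : Prop :=
  ¬ ∃ f : ℕ → Subst F, ∀ n : ℕ, InstLT E Set.univ (f (n + 1)) (f n)


/-- `Γ` is a NUOF `E`-unification problem: `Γ = {s ≈ t}` with disjoint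
variables, and some `≤_E^V`-minimal unifier of `Γ` belonging to `C_E(Γ)`
uses a fresh variable. -/
def NUOF {F : ℕ → Type} (E Γ : Set (Term F × Term F)) : Prop :=
  ∃ s t : Term F, Γ = {(s, t)} ∧ s.vars ∩ t.vars = ∅ ∧
    ∃ σ : Subst F, MinUnifier E Γ Set.univ σ ∧ σ ∈ CSet E Γ ∧
      (σ.VRan \ (s.vars ∪ t.vars)).Nonempty

theorem Term.finite_vars (t : Term F) : t.vars.Finite := by
  induction t with
  | var x => exact Set.finite_singleton x
  | app n f ts ih => exact Set.finite_iUnion ih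

theorem Subst.finite_VRan (σ : Subst F) : σ.VRan.Finite :=
  σ.finite_dom.biUnion fun _ _ => Term.finite_vars _

theorem Term.mem_vars_subst (σ : ℕ → Term F) (t : Term F) (y : ℕ) :
    y ∈ (t.subst σ).vars ↔ ∃ x ∈ t.vars, y ∈ (σ x).vars := by
  induction t with
  | var x => simp [Term.subst, Term.vars]
  | app n f ts ih =>
    simp only [Term.subst, Term.vars, Set.mem_iUnion, ih]
    tauto

theorem Term.subst_congr {σ τ : ℕ → Term F} (t : Term F) (h : ∀ x ∈ t.vars, σ x = τ x) :
    t.subst σ = t.subst τ := by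
  induction t with
  | var x => exact h x rfl
  | app n f ts ih =>
    simp only [Term.subst]
    congr 1
    funext i
    exact ih i fun x hx => h x (Set.mem_iUnion.2 ⟨i, hx⟩)

theorem Term.subst_subst (σ τ : ℕ → Term F) (t : Term F) :
    (t.subst σ).subst τ = t.subst fun x => (σ x).subst τ := by
  induction t with
  | var x => rfl
  | app n f ts ih => simp only [Term.subst, ih]

theorem EqE.subst {E : Set (Term F × Term F)} {s t : Term F} (h : EqE E s t)
    (τ : ℕ → Term F) : EqE E (s.subst τ) (t.subst τ) := by
  induction h with
  | ax σ hst =>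
    rw [Term.subst_subst, Term.subst_subst]
    exact .ax _ hst
  | refl t => exact .refl _
  | symm _ ih => exact ih.symm
  | trans _ _ ih₁ ih₂ => exact ih₁.trans ih₂
  | congr f _ ih => exact .congr f ih

theorem Regular.vars_eq {E : Set (Term F × Term F)} (hreg : Regular E) {s t : Term F}
    (h : EqE E s t) : s.vars = t.vars := by
  induction h with
  | ax σ hst =>
    ext y
    rw [Term.mem_vars_subst, Term.mem_vars_subst, hreg _ hst]
  | refl t => rfl
  | symm _ ih => exact ih.symm
  | trans _ _ ih₁ ih₂ => exact ih₁.trans ih₂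
  | congr f _ ih => simp only [Term.vars, ih]

/-- The substitution applying first `σ`, then `τ`. -/
def Subst.comp (τ σ : Subst F) : Subst F where
  toFun x := (σ.toFun x).subst τ.toFun
  finite_dom := by
    refine (σ.finite_dom.union τ.finite_dom).subset fun x hx => ?_
    by_contra h
    simp only [Set.mem_union, Set.mem_ofPred_eq, not_or, not_not] at h
    exact hx (by rw [h.1, Term.subst, h.2])

theorem InstLE.trans {E : Set (Term F × Term F)} {X : Set ℕ} {σ τ θ : Subst F}
    (h₁ : InstLE E X σ τ) (h₂ : InstLE E X τ θ) : InstLE E X σ θ := by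
  obtain ⟨l, hl⟩ := h₁
  obtain ⟨m, hm⟩ := h₂
  refine ⟨m.comp l, fun x hx => ?_⟩
  have h := ((hl x hx).subst m.toFun).trans (hm x hx)
  rwa [Term.subst_subst] at h

/-- The substitution obtained from `σ` by exchanging the images of `z` and `w`. -/
def Subst.swap (σ : Subst F) (z w : ℕ) : Subst F where
  toFun x := σ.toFun (Equiv.swap z w x)
  finite_dom := by
    refine (σ.finite_dom.union (Set.toFinite {z, w})).subset fun x hx => ?_
    by_contra h
    simp only [Set.mem_union, Set.mem_ofPred_eq, not_or, not_not, Set.mem_insert_iff,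
      Set.mem_singleton_iff] at h
    exact hx (by rw [Equiv.swap_apply_of_ne_of_ne h.2.1 h.2.2, h.1])

theorem Subst.swap_swap (σ : Subst F) (z w : ℕ) : (σ.swap z w).swap z w = σ := by
  cases σ
  simp [Subst.swap]

theorem InstLE.swap {E : Set (Term F × Term F)} {σ θ : Subst F}
    (h : InstLE E Set.univ σ θ) (z w : ℕ) :
    InstLE E Set.univ (σ.swap z w) (θ.swap z w) :=
  h.imp fun _ hl _ _ => hl _ (Set.mem_univ _)

theorem Unifier.swap {E : Set (Term F × Term F)} {s t : Term F} {σ : Subst F}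
    (h : Unifier E {(s, t)} σ) {z w : ℕ} (hz : z ∉ s.vars ∪ t.vars)
    (hw : w ∉ s.vars ∪ t.vars) : Unifier E {(s, t)} (σ.swap z w) := by
  have key : ∀ x ∈ s.vars ∪ t.vars, (σ.swap z w).toFun x = σ.toFun x := fun x hx =>
    congrArg σ.toFun (Equiv.swap_apply_of_ne_of_ne (ne_of_mem_of_not_mem hx hz)
      (ne_of_mem_of_not_mem hx hw))
  rintro p rfl
  have h' := h (s, t) rfl
  dsimp only at h' ⊢
  rwa [Term.subst_congr s fun x hx => key x (Or.inl hx),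
    Term.subst_congr t fun x hx => key x (Or.inr hx)]

theorem MinUnifier.swap {E : Set (Term F × Term F)} {s t : Term F} {σ : Subst F}
    (h : MinUnifier E {(s, t)} Set.univ σ) {z w : ℕ} (hz : z ∉ s.vars ∪ t.vars)
    (hw : w ∉ s.vars ∪ t.vars) : MinUnifier E {(s, t)} Set.univ (σ.swap z w) := by
  refine ⟨h.1.swap hz hw, fun θ hθ hle => ?_⟩
  have h₁ := hle.swap z w
  rw [Subst.swap_swap] at h₁
  have h₂ := (h.2 _ (hθ.swap hz hw) h₁).swap z w
  rwa [Subst.swap_swap] at h₂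

/-- Exchanging a range variable `z` of `σ ∈ C_E(Γ)` with different variables unused by `σ`
gives incomparable substitutions. -/
theorem Regular.not_instLE_swap {E Γ : Set (Term F × Term F)} (hreg : Regular E) {σ : Subst F}
    (hσ : σ ∈ CSet E Γ) {z w w' : ℕ} (hz : z ∈ σ.VRan) (hw : w ∉ σ.Dom ∪ σ.VRan)
    (hw' : w' ∉ σ.Dom ∪ σ.VRan) (hne : w ≠ w') :
    ¬ InstLE E Set.univ (σ.swap z w) (σ.swap z w') := by
  rintro ⟨l, hl⟩
  have hwz : w ≠ z := fun h => hw (Or.inr (h ▸ hz))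
  have fix : ∀ {v}, v ∉ σ.Dom ∪ σ.VRan → σ.toFun v = .var v := fun hv => by
    by_contra h
    exact hv (Or.inl h)
  have notin : ∀ x, x ≠ w → w ∉ (σ.toFun x).vars := by
    intro x hx hmem
    by_cases hd : x ∈ σ.Dom
    · exact hw (Or.inr (Set.mem_biUnion hd hmem))
    · rw [not_not.1 hd] at hmem
      exact hx hmem.symm
  have hwv := hreg.vars_eq (hl w (Set.mem_univ _))
  simp only [Subst.swap, Equiv.swap_apply_right, Equiv.swap_apply_of_ne_of_ne hwz hne,
    fix hw, Term.vars] at hwv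
  obtain ⟨u, hu, hwu⟩ := (Term.mem_vars_subst _ _ w).1 (hwv ▸ Set.mem_singleton w)
  have huR : u ∈ σ.VRan := by
    by_cases hd : z ∈ σ.Dom
    · exact Set.mem_biUnion hd hu
    · rw [not_not.1 hd] at hu
      exact (show u = z from hu) ▸ hz
  obtain ⟨x, hxz, hux⟩ : ∃ x, x ≠ z ∧ u ∈ (σ.toFun x).vars := by
    obtain ⟨x, x', hxx, hx, hx'⟩ := hσ.2 u huR
    by_cases h : x = z
    · exact ⟨x', fun h' => hxx (h.trans h'.symm), hx'⟩
    · exact ⟨x, h, hx⟩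
  have out : ∀ {v}, v ∉ σ.Dom ∪ σ.VRan → x ≠ v := by
    rintro v hv rfl
    rw [fix hv] at hux
    exact hv (Or.inr ((show u = x from hux) ▸ huR))
  have hxv := hreg.vars_eq (hl x (Set.mem_univ _))
  simp only [Subst.swap, Equiv.swap_apply_of_ne_of_ne hxz (out hw),
    Equiv.swap_apply_of_ne_of_ne hxz (out hw')] at hxv
  exact notin x (out hw) (hxv ▸ (Term.mem_vars_subst _ _ w).2 ⟨u, hux, hwu⟩)

/-- Theorem `NUOF:thm`: if `E` is a non-trivial regular
theory and `Γ` a NUOF `E`-unification problem, then `Γ` has no finite minimal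
complete set of `E`-unifiers w.r.t. the unrestricted instantiation preorder. -/
theorem stmt7 {F : ℕ → Type} (E : Set (Term F × Term F)) (hE : NonTrivial E)
    (hreg : Regular E) (Γ : Set (Term F × Term F)) (hN : NUOF E Γ) :
    ¬ ∃ S : Set (Subst F), S.Finite ∧ MinimalComplete E Γ Set.univ S := by
  rintro ⟨S, hfin, ⟨hunif, hcomp⟩, -⟩
  obtain ⟨s, t, rfl, -, σ, hmin, hC, z, hz, hzX⟩ := hN
  have hinf : ((s.vars ∪ t.vars) ∪ (σ.Dom ∪ σ.VRan))ᶜ.Infinite :=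
    ((s.finite_vars.union t.finite_vars).union
      (σ.finite_dom.union σ.finite_VRan)).infinite_compl
  have hbelow : ∀ w ∈ ((s.vars ∪ t.vars) ∪ (σ.Dom ∪ σ.VRan))ᶜ, ∃ τ ∈ S,
      InstLE E Set.univ τ (σ.swap z w) ∧ InstLE E Set.univ (σ.swap z w) τ := by
    intro w hw
    have hm := hmin.swap hzX fun h => hw (Or.inl h)
    obtain ⟨τ, hτ, hle⟩ := hcomp _ hm.1
    exact ⟨τ, hτ, hle, hm.2 τ (hunif τ hτ) hle⟩
  have : Nonempty (Subst F) := ⟨σ⟩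
  choose! f hfS hle hge using hbelow
  obtain ⟨w, hw, w', hw', hne, heq⟩ := hinf.exists_ne_map_eq_of_mapsTo hfS hfin
  exact hreg.not_instLE_swap hC hz (fun h => hw (Or.inr h)) (fun h => hw' (Or.inr h)) hne
    ((hge w hw).trans (heq ▸ hle w' hw'))
end UnifFW
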